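/- Let 0 < λ ≤ 2^{-6}, let 1 ≤ D < E ≤ L, let σ ∈ (0,1) and τ ∈ (0, η(D,E)], let P ∈ ℂ^{L×L} with ‖P‖ ≤ 1, let W ∈ 𝔾_{L,w} and let v ∈ ℂ^L be a unit vector with Wv = 0. Assume tr[(ζ̂^⊥)*Wζ̂^⊥] ≤ 2^{-3}λ, ‖𝔵(v)‖² ≤ σ, and ‖𝔷(v)‖² > (2/σ)(λ/τ). Then ‖𝔵((((e^{λP}ℛ)·W)^⊥(e^{λP}ℛ))∘v)‖² ≤ σ − 2^{-2}λ; in particular, if the dynamics is in the cone {‖𝔵(v)‖² ≤ σ} but outside the anti-cone {‖𝔷(v)‖² ≤ (2/σ)(λ/τ)}, it cannot leave the cone in one step. -/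

import Mathlib

open Matrix BigOperators

noncomputable section

/-- The squared Euclidean norm of a complex vector. -/
def sqNorm {n : ℕ} (v : Fin n → ℂ) : ℝ := ∑ i, ‖v i‖ ^ 2

/-- The Euclidean norm of a complex vector. -/
def vNorm {n : ℕ} (v : Fin n → ℂ) : ℝ := Real.sqrt (sqNorm v)

/-- The `ℓ² → ℓ²` operator norm of a rectangular complex matrix. -/
def opNorm {m n : ℕ} (A : Matrix (Fin m) (Fin n) ℂ) : ℝ :=
  ‖LinearMap.toContinuousLinearMap (Matrix.toEuclideanLin A)‖

/-- Membership in the Grassmannian `𝔾_{L,q}`: an orthogonal projection of rank `q`. -/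
def IsProjOfRank {L : ℕ} (q : ℕ) (Q : Matrix (Fin L) (Fin L) ℂ) : Prop :=
  Q * Q = Q ∧ Qᴴ = Q ∧ Q.trace = (q : ℂ)

/-- The action `T · Q` of an invertible matrix `T` on the Grassmannian: for `Q = ΦΦ*` this
equals `TΦ(Φ*T*TΦ)⁻¹Φ*T*`, i.e. the orthogonal projection onto `T (ran Q)`. -/
def grAct {L : ℕ} (T Q : Matrix (Fin L) (Fin L) ℂ) : Matrix (Fin L) (Fin L) ℂ :=
  T * Q * (Q * Tᴴ * T * Q + (1 - Q))⁻¹ * (Q * Tᴴ)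

/-- The matrix exponential. -/
def mexp {n : ℕ} (A : Matrix (Fin n) (Fin n) ℂ) : Matrix (Fin n) (Fin n) ℂ :=
  ∑' k : ℕ, ((k.factorial : ℂ))⁻¹ • A ^ k

/-- The normalized image `S ∘ v := Sv / ‖Sv‖`. -/
def circAct {n : ℕ} (S : Matrix (Fin n) (Fin n) ℂ) (v : Fin n → ℂ) : Fin n → ℂ :=
  ((vNorm (S.mulVec v) : ℂ))⁻¹ • S.mulVec v

/-- Relative gap `η(I,J) = 1 - κ_J²/κ_I²` (1-based indices). -/
def eta (κ : ℕ → ℝ) (i j : ℕ) : ℝ := 1 - κ j ^ 2 / κ i ^ 2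

/-- The diagonal matrix `ℛ = diag(κ_L, …, κ_1)` (top-to-bottom entries `κ_L, …, κ_1`). -/
def Rmat (κ : ℕ → ℝ) (L : ℕ) : Matrix (Fin L) (Fin L) ℂ :=
  Matrix.diagonal fun i : Fin L => (κ (L - (i : ℕ)) : ℂ)

/-- The frame consisting of the standard basis vectors `e_{s+1}, …, e_{s+r}`
(rows `s, …, s+r-1`). -/
def basisFrame (L r s : ℕ) : Matrix (Fin L) (Fin r) ℂ :=
  Matrix.of fun i j => if (i : ℕ) = s + (j : ℕ) then 1 else 0

/-- `‖𝔵(v)‖²`: squared norm of the top `L - E` entries of `v`. -/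
def xSq (E : ℕ) {L : ℕ} (v : Fin L → ℂ) : ℝ :=
  ∑ i : Fin L, if (i : ℕ) < L - E then ‖v i‖ ^ 2 else 0

/-- `‖𝔷(v)‖²`: squared norm of the bottom `D` entries of `v`. -/
def zSq (D : ℕ) {L : ℕ} (v : Fin L → ℂ) : ℝ :=
  ∑ i : Fin L, if L - D ≤ (i : ℕ) then ‖v i‖ ^ 2 else 0

/-- masked squared norm -/
def mSq {L : ℕ} (p : Fin L → Prop) [DecidablePred p] (v : Fin L → ℂ) : ℝ :=
  ∑ i : Fin L, if p i then ‖v i‖ ^ 2 else 0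

lemma mSq_nonneg {L : ℕ} (p : Fin L → Prop) [DecidablePred p] (v : Fin L → ℂ) : 0 ≤ mSq p v :=
  Finset.sum_nonneg fun i _ => by split_ifs <;> positivity

lemma mSq_compl {L : ℕ} (p : Fin L → Prop) [DecidablePred p] (v : Fin L → ℂ) :
    mSq p v + mSq (fun i => ¬ p i) v = sqNorm v := by
  unfold mSq sqNorm
  rw [← Finset.sum_add_distrib]
  refine Finset.sum_congr rfl fun i _ => ?_
  by_cases h : p i <;> simp [h]

lemma sqrt_mSq_eq {L : ℕ} (p : Fin L → Prop) [DecidablePred p] (v : Fin L → ℂ) :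
    √(mSq p v) = ‖(WithLp.toLp 2 (fun i => if p i then v i else 0) : EuclideanSpace ℂ (Fin L))‖ := by
  rw [EuclideanSpace.norm_eq]
  congr 1
  unfold mSq
  refine Finset.sum_congr rfl fun i _ => ?_
  by_cases h : p i <;> simp [h]

lemma sqrt_sqNorm_eq {L : ℕ} (v : Fin L → ℂ) :
    √(sqNorm v) = ‖(WithLp.toLp 2 v : EuclideanSpace ℂ (Fin L))‖ := by
  rw [EuclideanSpace.norm_eq]
  rfl

lemma sqrt_mSq_sub {L : ℕ} (p : Fin L → Prop) [DecidablePred p] (a u : Fin L → ℂ) :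
    |√(mSq p a) - √(mSq p u)| ≤ √(mSq p (a - u)) := by
  rw [sqrt_mSq_eq, sqrt_mSq_eq, sqrt_mSq_eq]
  refine (abs_norm_sub_norm_le _ _).trans (le_of_eq ?_)
  congr 1
  ext i
  by_cases h : p i <;> simp [h]

lemma pert_real (p q r s e f : ℝ) (hp : 0 ≤ p) (hq : 0 ≤ q) (hr : 0 ≤ r) (hs : 0 ≤ s)
    (N d n : ℝ) (hN : 0 ≤ N) (hd : 0 ≤ d) (hn : 0 ≤ n) (h1 : p ^ 2 + q ^ 2 = N ^ 2)
    (h2 : r ^ 2 + s ^ 2 = n ^ 2) (h3 : e ^ 2 + f ^ 2 = d ^ 2)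
    (h4 : |p - r| ≤ e) (h5 : |q - s| ≤ f) :
    p ^ 2 * n ^ 2 ≤ r ^ 2 * N ^ 2 + N ^ 2 * n * d := by
  have he : 0 ≤ e := (abs_nonneg _).trans h4
  have hf : 0 ≤ f := (abs_nonneg _).trans h5
  have A : p * s + r * q ≤ N * n := by
    refine (sq_le_sq₀ (by positivity) (by positivity)).1 ?_
    rw [mul_pow, ← h1, ← h2]
    nlinarith [sq_nonneg (p * r - q * s)]
  have B0 : p * f + q * e ≤ N * d := by
    refine (sq_le_sq₀ (by positivity) (by positivity)).1 ?_
    rw [mul_pow, ← h1, ← h3]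
    nlinarith [sq_nonneg (p * e - q * f)]
  have B : p * s - r * q ≤ N * d := by
    have := (abs_le.mp h4).2
    have := (abs_le.mp h5).1
    nlinarith
  have C : (p * s - r * q) * (p * s + r * q) ≤ (N * d) * (N * n) := by
    have : 0 ≤ p * s + r * q := by positivity
    calc _ ≤ (N * d) * (p * s + r * q) := mul_le_mul_of_nonneg_right B this
      _ ≤ _ := mul_le_mul_of_nonneg_left A (by positivity)
  have e : p ^ 2 * n ^ 2 - r ^ 2 * N ^ 2 = (p * s - r * q) * (p * s + r * q) := by
    rw [← h2, ← h1]; ring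
  linarith [e, C]

lemma pert {L : ℕ} (p : Fin L → Prop) [DecidablePred p] (a u : Fin L → ℂ) (δ c : ℝ)
    (hu : 0 < sqNorm u)
    (hd : √(sqNorm (a - u)) ≤ δ * √(sqNorm u)) (hc : mSq p u ≤ c * sqNorm u) :
    mSq p a ≤ (c + δ) * sqNorm a := by
  have nn : ∀ v : Fin L → ℂ, 0 ≤ sqNorm v := fun v => by unfold sqNorm; positivity
  have np : ∀ v : Fin L → ℂ, 0 ≤ mSq p v := mSq_nonneg p
  have nq : ∀ v : Fin L → ℂ, 0 ≤ mSq (fun i => ¬ p i) v := mSq_nonneg _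
  have := pert_real (√(mSq p a)) (√(mSq (fun i => ¬ p i) a)) (√(mSq p u))
    (√(mSq (fun i => ¬ p i) u)) (√(mSq p (a - u))) (√(mSq (fun i => ¬ p i) (a - u)))
    (by positivity) (by positivity) (by positivity) (by positivity)
    (√(sqNorm a)) (√(sqNorm (a - u))) (√(sqNorm u)) (by positivity) (by positivity) (by positivity)
    (by simp only [Real.sq_sqrt, nn, np, nq]; exact mSq_compl p a)
    (by simp only [Real.sq_sqrt, nn, np, nq]; exact mSq_compl p u)
    (by simp only [Real.sq_sqrt, nn, np, nq]; exact mSq_compl p (a - u))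
    (sqrt_mSq_sub p a u) (sqrt_mSq_sub _ a u)
  simp only [Real.sq_sqrt, nn, np, nq] at this
  have h2 : √(sqNorm u) * √(sqNorm (a - u)) ≤ δ * sqNorm u := by
    calc _ ≤ √(sqNorm u) * (δ * √(sqNorm u)) := mul_le_mul_of_nonneg_left hd (by positivity)
      _ = δ * (√(sqNorm u) * √(sqNorm u)) := by ring
      _ = _ := by rw [Real.mul_self_sqrt (nn u)]
  have h3 := mul_le_mul_of_nonneg_left h2 (nn a)
  have h4 := mul_le_mul_of_nonneg_right hc (nn a)
  have : mSq p a * sqNorm u ≤ ((c + δ) * sqNorm a) * sqNorm u := by nlinarith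
  exact le_of_mul_le_mul_right this hu

section
open scoped Matrix.Norms.L2Operator

lemma mexp_bound {L : ℕ} (A : Matrix (Fin L) (Fin L) ℂ) (l : ℝ) (hA : ‖A‖ ≤ l) :
    ‖mexp A - 1‖ ≤ Real.exp l - 1 := by
  have hs : Summable fun k : ℕ => ((k.factorial : ℂ))⁻¹ • A ^ k :=
    NormedSpace.expSeries_summable' (𝕂 := ℂ) A
  have e1 : mexp A - 1 = ∑' k : ℕ, (((k+1).factorial : ℂ))⁻¹ • A ^ (k+1) := by
    unfold mexp
    rw [hs.tsum_eq_zero_add]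
    simp
  have hr : HasSum (fun k : ℕ => l ^ k / (k.factorial : ℝ)) (Real.exp l) := by
    rw [Real.exp_eq_exp_ℝ]
    exact NormedSpace.expSeries_div_hasSum_exp l
  have hr1 : HasSum (fun k : ℕ => l ^ (k+1) / ((k+1).factorial : ℝ)) (Real.exp l - 1) := by
    have := (hasSum_nat_add_iff' 1).2 hr
    simpa using this
  rw [e1]
  refine tsum_of_norm_bounded hr1 fun k => ?_
  rw [norm_smul, norm_inv, Complex.norm_natCast, div_eq_inv_mul]
  gcongr
  exact (norm_pow_le' A (Nat.succ_pos k)).trans (by gcongr)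

lemma mexp_mulVec {L : ℕ} (P : Matrix (Fin L) (Fin L) ℂ) (l : ℝ) (hl : 0 ≤ l)
    (hP : opNorm P ≤ 1) (u : Fin L → ℂ) :
    √(sqNorm ((mexp ((l : ℂ) • P)) *ᵥ u - u)) ≤ (Real.exp l - 1) * √(sqNorm u) := by
  have hP' : ‖P‖ ≤ 1 := hP
  have h := mexp_bound ((l : ℂ) • P) l (by
    rw [norm_smul, Complex.norm_real, Real.norm_of_nonneg hl]; nlinarith)
  have h2 := Matrix.l2_opNorm_mulVec (mexp ((l : ℂ) • P) - 1) (WithLp.toLp 2 u)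
  rw [sqrt_sqNorm_eq, sqrt_sqNorm_eq]
  rw [Matrix.sub_mulVec, Matrix.one_mulVec] at h2
  exact h2.trans (mul_le_mul_of_nonneg_right h (norm_nonneg _))
end

lemma proj_row {L w : ℕ} (W : Matrix (Fin L) (Fin L) ℂ) (hW : IsProjOfRank w W) (i : Fin L) :
    ∑ j, ‖W i j‖ ^ 2 = (W i i).re := by
  have h : (W * Wᴴ) i i = W i i := by rw [hW.2.1, hW.1]
  rw [← h, Matrix.mul_apply, Complex.re_sum]
  refine Finset.sum_congr rfl fun j _ => ?_
  rw [Matrix.conjTranspose_apply, Complex.star_def, Complex.mul_conj, Complex.normSq_eq_norm_sq]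
  norm_cast

lemma row_bound {L : ℕ} (r ω : Fin L → ℂ) :
    ‖∑ j, r j * ω j‖ ^ 2 ≤ (∑ j, ‖r j‖ ^ 2) * sqNorm ω := by
  have : ‖∑ j, r j * ω j‖ ≤ ∑ j, ‖r j‖ * ‖ω j‖ :=
    (norm_sum_le _ _).trans (by simp)
  calc _ ≤ (∑ j, ‖r j‖ * ‖ω j‖) ^ 2 := by gcongr
    _ ≤ _ := Finset.sum_mul_sq_le_sq_mul_sq _ _ _

lemma trace_eq {L m : ℕ} (hm : m ≤ L) (W : Matrix (Fin L) (Fin L) ℂ) :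
    ((basisFrame L m 0)ᴴ * W * basisFrame L m 0).trace.re
      = ∑ i : Fin L, if (i : ℕ) < m then (W i i).re else 0 := by
  have : ∀ j : Fin m, ((basisFrame L m 0)ᴴ * W * basisFrame L m 0) j j
      = W (Fin.castLE hm j) (Fin.castLE hm j) := by
    intro j
    have e : ∀ i : Fin L, ((i : ℕ) = (j : ℕ)) ↔ i = Fin.castLE hm j := by
      intro i; rw [Fin.ext_iff]; rfl
    simp [Matrix.mul_apply, basisFrame, e, apply_ite]
  simp only [Matrix.trace, Matrix.diag, this, Complex.re_sum]
  rw [← Finset.sum_filter]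
  refine Finset.sum_bij (fun j _ => Fin.castLE hm j) ?_ ?_ ?_ ?_
  · intro j _; simp
  · intro a _ b _ h; exact Fin.castLE_injective hm h
  · intro b hb
    exact ⟨⟨b, (Finset.mem_filter.1 hb).2⟩, Finset.mem_univ _, rfl⟩
  · intro a _; rfl

lemma W_bound {L w m : ℕ} (hm : m ≤ L) (W : Matrix (Fin L) (Fin L) ℂ) (hW : IsProjOfRank w W)
    (t : ℝ) (ht : ((basisFrame L m 0)ᴴ * W * basisFrame L m 0).trace.re ≤ t)
    (ω : Fin L → ℂ) (hω : W *ᵥ ω = ω) :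
    mSq (fun i : Fin L => (i : ℕ) < m) ω ≤ t * sqNorm ω := by
  have nn : 0 ≤ sqNorm ω := by unfold sqNorm; positivity
  refine le_trans ?_ (mul_le_mul_of_nonneg_right ht nn)
  rw [trace_eq hm, Finset.sum_mul]
  refine Finset.sum_le_sum fun i _ => ?_
  split_ifs
  · rw [← proj_row W hW i]
    have := row_bound (W i) ω
    have e : ∑ j, W i j * ω j = ω i := congrFun hω i
    rwa [e] at this
  · simp

lemma orth {L w : ℕ} (W : Matrix (Fin L) (Fin L) ℂ) (hW : IsProjOfRank w W)
    (v ω : Fin L → ℂ) (hv : W *ᵥ v = 0) (hω : W *ᵥ ω = ω) :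
    sqNorm (v - ω) = sqNorm v + sqNorm ω := by
  have h0 : star v ⬝ᵥ ω = 0 := by
    rw [← hω, Matrix.dotProduct_mulVec, ← hW.2.1, ← Matrix.star_mulVec, hv]
    simp
  have h1 : ∑ i, (star (v i) * ω i).re = 0 := by
    have := congrArg Complex.re h0
    simpa only [dotProduct, Complex.re_sum, Pi.star_apply, Complex.zero_re] using this
  unfold sqNorm
  rw [← Finset.sum_add_distrib, ← sub_eq_zero, ← Finset.sum_sub_distrib]
  have : ∀ i, ‖(v - ω) i‖ ^ 2 - (‖v i‖ ^ 2 + ‖ω i‖ ^ 2) = (-2) * (star (v i) * ω i).re := by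
    intro i
    simp only [← Complex.normSq_eq_norm_sq, Complex.normSq_apply, Pi.sub_apply, Complex.sub_re,
      Complex.sub_im, Complex.mul_re, Complex.star_def, Complex.conj_re, Complex.conj_im]
    ring
  simp only [this, ← Finset.mul_sum, h1, mul_zero]

lemma young {L : ℕ} (p : Fin L → Prop) [DecidablePred p] (v ω : Fin L → ℂ) (t : ℝ) (ht : 0 ≤ t)
    (hb : mSq p ω ≤ t * sqNorm ω) :
    mSq p (v - ω) ≤ (mSq p v + t) * (1 + sqNorm ω) := by
  have nn : 0 ≤ sqNorm ω := by unfold sqNorm; positivity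
  rcases nn.eq_or_lt with h | h
  · have hz : ω = 0 := by
      funext i
      have h' : ∑ i, ‖ω i‖ ^ 2 = 0 := h.symm
      rw [Finset.sum_eq_zero_iff_of_nonneg (fun i _ => by positivity)] at h'
      simpa using h' i (Finset.mem_univ i)
    subst hz
    rw [← h, sub_zero]
    linarith
  · have key : sqNorm ω * mSq p (v - ω) ≤
        sqNorm ω * (1 + sqNorm ω) * mSq p v + (1 + sqNorm ω) * mSq p ω := by
      unfold mSq
      rw [Finset.mul_sum, Finset.mul_sum, Finset.mul_sum, ← Finset.sum_add_distrib]
      refine Finset.sum_le_sum fun i _ => ?_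
      split_ifs
      · have h3 : ‖(v - ω) i‖ ≤ ‖v i‖ + ‖ω i‖ := norm_sub_le _ _
        have h4 : ‖(v - ω) i‖ ^ 2 ≤ (‖v i‖ + ‖ω i‖) ^ 2 := by gcongr
        nlinarith [sq_nonneg (sqNorm ω * ‖v i‖ - ‖ω i‖)]
      · simp
    have h5 : (1 + sqNorm ω) * mSq p ω ≤ (1 + sqNorm ω) * (t * sqNorm ω) := by gcongr
    have : sqNorm ω * mSq p (v - ω) ≤ sqNorm ω * ((mSq p v + t) * (1 + sqNorm ω)) := by nlinarith
    exact le_of_mul_le_mul_left this h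

lemma rstep_real (p y z X Y Z k K τ : ℝ) (hX : 0 ≤ X) (hY : 0 ≤ Y) (hZ : 0 ≤ Z)
    (hk : 0 < k) (hkK : k ≤ (1 - τ) * K) (hτ : 0 < τ) (hτ1 : τ ≤ 1)
    (hpX : p ≤ k * X) (hy : k * Y ≤ y) (hz : K * Z ≤ z) :
    p * (X + Y + Z) ^ 2 ≤ X * ((X + Y + Z) - τ * Z) * (p + y + z) := by
  have hK : 0 < K := by
    by_contra h
    nlinarith
  obtain ⟨S, hS⟩ : ∃ S, S = X + Y + Z := ⟨_, rfl⟩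
  rw [← hS]
  have hZS : Z ≤ S := by linarith
  have hS0 : 0 ≤ S := by linarith
  have hτZ : τ * Z ≤ S := by nlinarith
  have hτZ0 : 0 ≤ τ * Z := by positivity
  have a1 : 0 ≤ S - τ * Z := by linarith
  have a2 : 0 ≤ S ^ 2 - X * (S - τ * Z) := by
    have : X * (S - τ * Z) ≤ S * S := mul_le_mul (by linarith) (by linarith) a1 hS0
    nlinarith
  have a3 : p * (S ^ 2 - X * (S - τ * Z)) ≤ k * X * (S ^ 2 - X * (S - τ * Z)) :=
    mul_le_mul_of_nonneg_right hpX a2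
  have a4 : X * (S - τ * Z) * (k * Y + K * Z) ≤ X * (S - τ * Z) * (y + z) :=
    mul_le_mul_of_nonneg_left (by linarith) (by positivity)
  have a5 : k * S + K * (τ * Z) ≤ k * X + k * Y + K * Z := by
    have := mul_le_mul_of_nonneg_right hkK hZ
    rw [hS]; nlinarith
  have a6 : k * S ^ 2 ≤ (S - τ * Z) * (k * S + K * (τ * Z)) := by
    have b1 : K * τ * S ≤ (K - k) * S := mul_le_mul_of_nonneg_right (by linarith) hS0
    have b2 : K * τ * (τ * Z) ≤ K * τ * S := mul_le_mul_of_nonneg_left hτZ (by positivity)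
    have b3 : 0 ≤ (τ * Z) * (K * S - k * S - K * (τ * Z)) := by
      apply mul_nonneg hτZ0
      have b4 : K * (τ * Z) ≤ K * (τ * S) := by gcongr
      nlinarith
    nlinarith
  have a7 : (S - τ * Z) * (k * S + K * (τ * Z)) ≤ (S - τ * Z) * (k * X + k * Y + K * Z) :=
    mul_le_mul_of_nonneg_left a5 a1
  have a8 := mul_le_mul_of_nonneg_left (a6.trans a7) hX
  nlinarith

lemma final_real (p U X Z S σ lam τ z0 : ℝ) (hS : 0 < S) (hU : 0 ≤ U) (hX : 0 ≤ X)
    (hσ0 : 0 < σ) (hσ1 : σ < 1) (hl : 0 < lam) (hτ0 : 0 < τ) (hτ1 : τ ≤ 1)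
    (hZS : Z ≤ S)
    (h1 : p * S ^ 2 ≤ X * (S - τ * Z) * U) (hXS : X ≤ (σ + lam / 8) * S)
    (hZ : (z0 - lam / 8) * S ≤ Z) (hz0 : 2 / σ * (lam / τ) < z0) :
    p ≤ (σ - 7 / 4 * lam + lam ^ 2 / 64) * U := by
  have hz : 2 * lam < z0 * (σ * τ) := by
    have : 2 / σ * (lam / τ) = 2 * lam / (σ * τ) := by field_simp
    rw [this, div_lt_iff₀ (by positivity)] at hz0
    exact hz0
  have a1 : S - τ * Z ≤ (1 - τ * (z0 - lam / 8)) * S := by nlinarith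
  have a0 : 0 ≤ S - τ * Z := by nlinarith
  have a2 : X * (S - τ * Z) ≤ ((σ + lam / 8) * S) * ((1 - τ * (z0 - lam / 8)) * S) :=
    mul_le_mul hXS a1 a0 (by positivity)
  have hc : (σ + lam / 8) * (1 - τ * (z0 - lam / 8)) ≤ σ - 7 / 4 * lam + lam ^ 2 / 64 := by
    have c1 : σ * τ * lam ≤ lam := by
      have : σ * τ ≤ 1 := by nlinarith
      nlinarith
    have c2 : 0 ≤ τ * z0 * lam := by
      have : 0 < z0 := lt_trans (by positivity) hz0
      positivity
    nlinarith [mul_le_mul_of_nonneg_right hτ1 (sq_nonneg lam)]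
  have a3 : X * (S - τ * Z) ≤ (σ - 7 / 4 * lam + lam ^ 2 / 64) * S ^ 2 := by
    have := mul_le_mul_of_nonneg_right hc (sq_nonneg S)
    nlinarith
  have a4 := mul_le_mul_of_nonneg_right a3 hU
  have : p * S ^ 2 ≤ ((σ - 7 / 4 * lam + lam ^ 2 / 64) * U) * S ^ 2 := by nlinarith
  exact le_of_mul_le_mul_right this (by positivity)

lemma grAct_step {L : ℕ} (T W : Matrix (Fin L) (Fin L) ℂ) (v : Fin L → ℂ) :
    ∃ c : Fin L → ℂ, ((1 - grAct T W) * T) *ᵥ v = T *ᵥ (v - W *ᵥ c) := by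
  refine ⟨((W * Tᴴ * T * W + (1 - W))⁻¹ * (W * Tᴴ) * T) *ᵥ v, ?_⟩
  rw [Matrix.mulVec_sub, Matrix.mulVec_mulVec, Matrix.mulVec_mulVec, ← Matrix.sub_mulVec]
  congr 1
  unfold grAct
  noncomm_ring

lemma xSq_circAct {L E : ℕ} (S : Matrix (Fin L) (Fin L) ℂ) (v : Fin L → ℂ) (c : ℝ) (hc : 0 ≤ c)
    (h : xSq E (S *ᵥ v) ≤ c * sqNorm (S *ᵥ v)) : xSq E (circAct S v) ≤ c := by
  have nn : 0 ≤ sqNorm (S *ᵥ v) := by unfold sqNorm; positivity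
  have e : xSq E (circAct S v) = (sqNorm (S *ᵥ v))⁻¹ * xSq E (S *ᵥ v) := by
    unfold xSq
    rw [Finset.mul_sum]
    refine Finset.sum_congr rfl fun i _ => ?_
    split_ifs
    · unfold circAct vNorm
      rw [Pi.smul_apply, norm_smul, norm_inv, Complex.norm_real, Real.norm_of_nonneg (by positivity),
        mul_pow, inv_pow, Real.sq_sqrt nn]
    · simp
  rw [e]
  rcases nn.eq_or_lt with h0 | h0
  · rw [← h0]; simpa using hc
  · rw [inv_mul_le_iff₀ h0, mul_comm]; exact h

lemma Rmat_mulVec {L : ℕ} (κ : ℕ → ℝ) (v : Fin L → ℂ) (i : Fin L) :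
    ‖(Rmat κ L *ᵥ v) i‖ ^ 2 = κ (L - (i : ℕ)) ^ 2 * ‖v i‖ ^ 2 := by
  unfold Rmat
  rw [Matrix.mulVec_diagonal, norm_mul, Complex.norm_real, mul_pow, Real.norm_eq_abs, sq_abs]

lemma mSq_three {L D E : ℕ} (hDE : D < E) (v : Fin L → ℂ) :
    sqNorm v = mSq (fun i : Fin L => (i : ℕ) < L - E) v
      + mSq (fun i : Fin L => L - E ≤ (i : ℕ) ∧ (i : ℕ) < L - D) v
      + mSq (fun i : Fin L => L - D ≤ (i : ℕ)) v := by
  unfold mSq sqNorm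
  rw [← Finset.sum_add_distrib, ← Finset.sum_add_distrib]
  refine Finset.sum_congr rfl fun i _ => ?_
  by_cases h1 : (i : ℕ) < L - E
  · have h2 : ¬ (L - D ≤ (i : ℕ)) := by omega
    have h3 : ¬ (L - E ≤ (i : ℕ)) := by omega
    simp [h1, h2, h3]
  · by_cases h2 : (i : ℕ) < L - D
    · have h3 : ¬ (L - D ≤ (i : ℕ)) := by omega
      have h4 : (L - E ≤ (i : ℕ)) := by omega
      simp [h1, h2, h3, h4]
    · have h3 : (L - D ≤ (i : ℕ)) := by omega
      simp [h1, h2, h3]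

/-- the dynamics cannot leave a cone without entering the anti-cone:
if `tr[(ζ̂^⊥)*Wζ̂^⊥] ≤ 2^{-3}λ`, `‖𝔵(v)‖² ≤ σ` and `‖𝔷(v)‖² > (2/σ)(λ/τ)` for
`σ ∈ (0,1)` and `τ ∈ (0, η(D,E)]`, then
`‖𝔵((((e^{λP}ℛ)·W)^⊥(e^{λP}ℛ))∘v)‖² ≤ σ − 2^{-2}λ`. -/
theorem statement13 (L D E w : ℕ) (hD : 1 ≤ D) (hDE : D < E) (hE : E ≤ L)
    (lam : ℝ) (hlam0 : 0 < lam) (hlam : lam ≤ 1 / 2 ^ 6)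
    (σ τ : ℝ) (hσ0 : 0 < σ) (hσ1 : σ < 1)
    (κ : ℕ → ℝ)
    (hκpos : ∀ i, 1 ≤ i → i ≤ L → 0 < κ i)
    (hκmono : ∀ i j, 1 ≤ i → i ≤ j → j ≤ L → κ j ≤ κ i)
    (hτ0 : 0 < τ) (hτ : τ ≤ eta κ D E)
    (P : Matrix (Fin L) (Fin L) ℂ) (hP : opNorm P ≤ 1)
    (W : Matrix (Fin L) (Fin L) ℂ) (hW : IsProjOfRank w W)
    (v : Fin L → ℂ) (hv : sqNorm v = 1) (hWv : W.mulVec v = 0)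
    (hover : ((basisFrame L (L - D) 0)ᴴ * W * basisFrame L (L - D) 0).trace.re
      ≤ 2⁻¹ ^ 3 * lam)
    (hcone : xSq E v ≤ σ)
    (hanticone : 2 / σ * (lam / τ) < zSq D v) :
    xSq E (circAct ((1 - grAct (mexp ((lam : ℂ) • P) * Rmat κ L) W)
        * (mexp ((lam : ℂ) • P) * Rmat κ L)) v) ≤ σ - 2⁻¹ ^ 2 * lam := by
  have hm : L - D ≤ L := Nat.sub_le _ _
  have hκE := hκpos E (by omega) hE
  have hκD := hκpos D hD (by omega)
  have hgap : κ E ^ 2 ≤ (1 - τ) * κ D ^ 2 := by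
    have h1 : κ E ^ 2 / κ D ^ 2 ≤ 1 - τ := by unfold eta at hτ; linarith
    rwa [div_le_iff₀ (by positivity)] at h1
  have hτ1 : τ ≤ 1 := by
    unfold eta at hτ
    have : 0 ≤ κ E ^ 2 / κ D ^ 2 := by positivity
    linarith
  have hzle : zSq D v ≤ 1 := by
    rw [← hv]
    unfold zSq sqNorm
    refine Finset.sum_le_sum fun i _ => ?_
    split_ifs
    · exact le_rfl
    · positivity
  have hσlam : 2 * lam < σ := by
    have h1 := hanticone.trans_le hzle
    have : 2 / σ * (lam / τ) = 2 * lam / (σ * τ) := by field_simp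
    rw [this, div_lt_one (by positivity)] at h1
    nlinarith only [h1, hτ1, hσ0]
  obtain ⟨c, hc⟩ := grAct_step (mexp ((lam : ℂ) • P) * Rmat κ L) W v
  obtain ⟨ω, hω⟩ : ∃ ω, ω = W *ᵥ c := ⟨_, rfl⟩
  rw [← hω, ← Matrix.mulVec_mulVec (v - ω)] at hc
  have hWω : W *ᵥ ω = ω := by rw [hω, Matrix.mulVec_mulVec, hW.1]
  have hωn : 0 ≤ sqNorm ω := by unfold sqNorm; positivity
  have hS : sqNorm (v - ω) = 1 + sqNorm ω := by rw [orth W hW v ω hWv hWω, hv]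
  have hb1 : mSq (fun i : Fin L => (i : ℕ) < L - D) ω ≤ (lam / 8) * sqNorm ω := by
    have := W_bound hm W hW _ hover ω hWω
    refine this.trans (le_of_eq ?_)
    ring
  have hb2 : mSq (fun i : Fin L => (i : ℕ) < L - E) ω ≤ (lam / 8) * sqNorm ω := by
    refine le_trans ?_ hb1
    refine Finset.sum_le_sum fun i _ => ?_
    by_cases h1 : (i : ℕ) < L - E
    · have h2 : (i : ℕ) < L - D := by omega
      simp [h1, h2]
    · rw [if_neg h1]
      split_ifs <;> positivity
  have hx := young _ v ω (lam / 8) (by positivity) hb2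
  have hy := young _ v ω (lam / 8) (by positivity) hb1
  rw [← hS] at hx hy
  have hSpos : 0 < sqNorm (v - ω) := by rw [hS]; linarith
  have split2 : ∀ a : Fin L → ℂ, mSq (fun i : Fin L => (i : ℕ) < L - D) a
      + mSq (fun i : Fin L => L - D ≤ (i : ℕ)) a = sqNorm a := by
    intro a
    rw [← mSq_compl (fun i : Fin L => (i : ℕ) < L - D) a]
    simp only [not_lt]
  have hcone' : mSq (fun i : Fin L => (i : ℕ) < L - E) v ≤ σ := hcone
  have hzdef : zSq D v = mSq (fun i : Fin L => L - D ≤ (i : ℕ)) v := rfl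
  have s1 := split2 v
  have s2 := split2 (v - ω)
  rw [hv, ← hzdef] at s1
  have s3 := mSq_three hDE (v - ω)
  have s4 := mSq_three hDE (Rmat κ L *ᵥ (v - ω))
  obtain ⟨u, hu⟩ : ∃ u, u = Rmat κ L *ᵥ (v - ω) := ⟨_, rfl⟩
  have hui : ∀ i : Fin L, ‖u i‖ ^ 2 = κ (L - (i : ℕ)) ^ 2 * ‖(v - ω) i‖ ^ 2 := by
    intro i; rw [hu, Rmat_mulVec]
  rw [← hu] at s4
  have r1 : mSq (fun i : Fin L => (i : ℕ) < L - E) u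
      ≤ κ E ^ 2 * mSq (fun i : Fin L => (i : ℕ) < L - E) (v - ω) := by
    unfold mSq
    rw [Finset.mul_sum]
    refine Finset.sum_le_sum fun i _ => ?_
    split_ifs with h
    · rw [hui]
      have h1 := hκpos (L - (i : ℕ)) (by omega) (by omega)
      have h2 := hκmono E (L - (i : ℕ)) (by omega) (by omega) (by omega)
      gcongr
    · simp
  have r2 : κ E ^ 2 * mSq (fun i : Fin L => L - E ≤ (i : ℕ) ∧ (i : ℕ) < L - D) (v - ω)
      ≤ mSq (fun i : Fin L => L - E ≤ (i : ℕ) ∧ (i : ℕ) < L - D) u := by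
    unfold mSq
    rw [Finset.mul_sum]
    refine Finset.sum_le_sum fun i _ => ?_
    split_ifs with h
    · rw [hui]
      have h2 := hκmono (L - (i : ℕ)) E (by omega) (by omega) (by omega)
      gcongr
    · simp
  have r3 : κ D ^ 2 * mSq (fun i : Fin L => L - D ≤ (i : ℕ)) (v - ω)
      ≤ mSq (fun i : Fin L => L - D ≤ (i : ℕ)) u := by
    unfold mSq
    rw [Finset.mul_sum]
    refine Finset.sum_le_sum fun i _ => ?_
    split_ifs with h
    · rw [hui]
      have h2 := hκmono (L - (i : ℕ)) D (by omega) (by omega) (by omega)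
      gcongr
    · simp
  have q1 := rstep_real _ _ _ _ _ _ _ _ τ (mSq_nonneg _ _) (mSq_nonneg _ _) (mSq_nonneg _ _)
    (by positivity) hgap hτ0 hτ1 r1 r2 r3
  rw [← s3, ← s4] at q1
  have hunn : 0 ≤ sqNorm u := by unfold sqNorm; positivity
  have hZS : (zSq D v - lam / 8) * sqNorm (v - ω)
      ≤ mSq (fun i : Fin L => L - D ≤ (i : ℕ)) (v - ω) := by
    have e : mSq (fun i : Fin L => (i : ℕ) < L - D) v = 1 - zSq D v := by linarith only [s1]
    rw [e] at hy
    linarith only [hy, s2]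
  have q2 := final_real _ _ _ _ _ σ lam τ (zSq D v) hSpos hunn (mSq_nonneg _ _) hσ0 hσ1 hlam0
    hτ0 hτ1 (by linarith [mSq_nonneg (fun i : Fin L => (i : ℕ) < L - D) (v - ω)]) q1
    (hx.trans (mul_le_mul_of_nonneg_right (by linarith) hSpos.le))
    hZS hanticone
  have hupos : 0 < sqNorm u := by
    have h0 : 0 < κ L ^ 2 := by
      have := hκpos L (by omega) le_rfl
      positivity
    have : κ L ^ 2 * sqNorm (v - ω) ≤ sqNorm u := by
      unfold sqNorm
      rw [Finset.mul_sum]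
      refine Finset.sum_le_sum fun i _ => ?_
      rw [hui]
      have h1 := hκpos L (by omega) le_rfl
      have h2 := hκmono (L - (i : ℕ)) L (by omega) (by omega) le_rfl
      gcongr
    exact lt_of_lt_of_le (by positivity) this
  have q3 := pert (fun i : Fin L => (i : ℕ) < L - E) (mexp ((lam : ℂ) • P) *ᵥ u) u
    (Real.exp lam - 1) _ hupos (mexp_mulVec P lam hlam0.le hP u) q2
  rw [← hu] at hc
  apply xSq_circAct _ _ _ (by linarith only [hσlam, hlam0])
  rw [hc]
  refine le_trans q3 (mul_le_mul_of_nonneg_right ?_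
    (Finset.sum_nonneg fun i _ => by positivity))
  have he := Real.norm_exp_sub_one_sub_id_le (x := lam)
    (by rw [Real.norm_of_nonneg hlam0.le]; linarith)
  rw [Real.norm_of_nonneg hlam0.le] at he
  have he' := (le_abs_self _).trans he
  nlinarith


end
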